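/- (Main concentration theorem) Let f(x) = ∏_{i=1}^m f_i(x_i) where each f_i is contractive with width w and gap 1−η. Then for every ε > 0, f's Fourier spectrum is ε-concentrated up to degree O(w log(1/ε) log_η ε) when η > 0, and up to degree O(w log(1/ε)) when η = 0; i.e., there is a universal constant C such that ∑_{|S| > k} f̂(S)² < ε for k = C·w·log(1/ε)·(⌈log_η ε⌉+1) (with the last factor replaced by 1 when η = 0). -/

import Mathlib

open scoped Classical

noncomputable def chi {n : ℕ} (S : Finset (Fin n)) (x : Fin n → Bool) : ℝ :=
  ∏ i ∈ S, (if x i then 1 else -1)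

noncomputable def fourierCoef {n : ℕ} (f : (Fin n → Bool) → ℝ) (S : Finset (Fin n)) : ℝ :=
  (∑ x : Fin n → Bool, f x * chi S x) / 2 ^ n

/-- g depends only on the variables in T. -/
def DependsOnlyOn {n : ℕ} (g : (Fin n → Bool) → ℝ) (T : Finset (Fin n)) : Prop :=
  ∀ x y : Fin n → Bool, (∀ i ∈ T, x i = y i) → g x = g y

/-- g has width at most w: it depends on at most w variables. -/
def HasWidth {n : ℕ} (g : (Fin n → Bool) → ℝ) (w : ℕ) : Prop :=
  ∃ T : Finset (Fin n), T.card ≤ w ∧ DependsOnlyOn g T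

/-- g is contractive with gap 1-η: nonnegative values at most 1, maximum value 1,
and any value strictly below 1 is at most η. -/
def Contractive {n : ℕ} (g : (Fin n → Bool) → ℝ) (η : ℝ) : Prop :=
  (∀ x, 0 ≤ g x) ∧ (∀ x, g x ≤ 1) ∧ (∃ x, g x = 1) ∧ (∀ x, g x < 1 → g x ≤ η)

/-- The point obtained from `x` by negating the coordinates in `P`. -/
def flipOn {n : ℕ} (P : Finset (Fin n)) (x : Fin n → Bool) : Fin n → Bool :=
  fun i => if i ∈ P then !x i else x i

lemma flipOn_flipOn {n : ℕ} (P : Finset (Fin n)) (x : Fin n → Bool) :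
    flipOn P (flipOn P x) = x := by
  funext i
  by_cases h : i ∈ P <;> simp [flipOn, h]

lemma flipOn_apply_of_notMem {n : ℕ} {P : Finset (Fin n)} {i : Fin n} (h : i ∉ P)
    (x : Fin n → Bool) : flipOn P x i = x i := by
  simp [flipOn, h]

lemma flipOn_flipOn_of_disjoint {n : ℕ} {P Q : Finset (Fin n)} (h : Disjoint P Q)
    (x : Fin n → Bool) : flipOn P (flipOn Q x) = flipOn (P ∪ Q) x := by
  funext i
  by_cases hP : i ∈ P
  · simp [flipOn, hP, Finset.disjoint_left.mp h hP]
  · by_cases hQ : i ∈ Q <;> simp [flipOn, hP, hQ]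

lemma exists_flipOn_eq {n : ℕ} {Y : Finset (Fin n)} {x y : Fin n → Bool}
    (h : ∀ i ∉ Y, x i = y i) : ∃ P ⊆ Y, flipOn P x = y := by
  refine ⟨Y.filter (fun i => x i ≠ y i), Finset.filter_subset _ _, ?_⟩
  funext i
  by_cases hi : i ∈ Y
  · by_cases hxy : x i = y i
    · simp [flipOn, hxy]
    · have : (!x i) = y i := by cases hx : x i <;> cases hy : y i <;> simp_all
      simp [flipOn, hi, hxy, this]
  · simp [flipOn, hi, h i hi]

lemma chi_mul_chi_sum {n : ℕ} (x y : Fin n → Bool) :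
    ∑ S : Finset (Fin n), chi S x * chi S y = if x = y then 2 ^ n else 0 := by
  have h : ∑ S : Finset (Fin n), chi S x * chi S y
      = ∏ i : Fin n, (1 + (if x i then (1 : ℝ) else -1) * (if y i then 1 else -1)) := by
    rw [Finset.prod_one_add, Finset.powerset_univ]
    simp only [chi, Finset.prod_mul_distrib]
  rw [h]
  split_ifs with hxy
  · subst hxy
    have : ∀ i : Fin n, (1 + (if x i then (1 : ℝ) else -1) * (if x i then 1 else -1)) = 2 := by
      intro i
      split_ifs <;> norm_num
    simp_rw [this]
    simp
  · obtain ⟨i, hi⟩ := Function.ne_iff.mp hxy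
    refine Finset.prod_eq_zero (Finset.mem_univ i) ?_
    cases hx : x i <;> cases hy : y i <;> simp_all

lemma parseval {n : ℕ} (f : (Fin n → Bool) → ℝ) :
    ∑ S : Finset (Fin n), fourierCoef f S ^ 2 = (∑ x, f x ^ 2) / 2 ^ n := by
  have h : ∀ S : Finset (Fin n), fourierCoef f S ^ 2
      = (∑ x, ∑ y, f x * f y * (chi S x * chi S y)) / (2 ^ n) ^ 2 := by
    intro S
    rw [fourierCoef, div_pow, sq (∑ x, f x * chi S x), Finset.sum_mul_sum]
    congr 1
    exact Finset.sum_congr rfl fun x _ => Finset.sum_congr rfl fun y _ => by ring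
  simp_rw [h]
  rw [← Finset.sum_div, Finset.sum_comm]
  have h2 : ∀ x : Fin n → Bool, ∑ S : Finset (Fin n), ∑ y, f x * f y * (chi S x * chi S y)
      = f x ^ 2 * 2 ^ n := by
    intro x
    rw [Finset.sum_comm]
    simp_rw [← Finset.mul_sum, chi_mul_chi_sum]
    simp [sq]
  simp_rw [h2]
  rw [← Finset.sum_mul]
  field_simp

/-- The alternating sum of `f` over the subcube through `x` in the directions of `T`. -/
noncomputable def altSum {n : ℕ} (f : (Fin n → Bool) → ℝ) (T : Finset (Fin n))
    (x : Fin n → Bool) : ℝ :=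
  ∑ P ∈ T.powerset, (-1) ^ P.card * f (flipOn P x)

lemma chi_flipOn {n : ℕ} {P S : Finset (Fin n)} (h : P ⊆ S) (x : Fin n → Bool) :
    chi S (flipOn P x) = (-1) ^ P.card * chi S x := by
  have h1 : (-1 : ℝ) ^ P.card = ∏ i ∈ S, (if i ∈ P then -1 else 1) := by
    rw [Finset.prod_ite_mem, Finset.inter_eq_right.mpr h, Finset.prod_const]
  rw [h1, chi, chi, ← Finset.prod_mul_distrib]
  refine Finset.prod_congr rfl fun i _ => ?_
  by_cases hi : i ∈ P <;> cases hx : x i <;> simp [flipOn, hi, hx]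

lemma fourierCoef_altSum {n : ℕ} (f : (Fin n → Bool) → ℝ) {T S : Finset (Fin n)} (h : T ⊆ S) :
    fourierCoef (altSum f T) S = 2 ^ T.card * fourierCoef f S := by
  have hP : ∀ P ∈ T.powerset, ∑ x, (-1) ^ P.card * f (flipOn P x) * chi S x
      = ∑ x, f x * chi S x := by
    intro P hP
    refine Finset.sum_bij' (fun x _ => flipOn P x) (fun x _ => flipOn P x) (by simp) (by simp)
      (fun x _ => flipOn_flipOn P x) (fun x _ => flipOn_flipOn P x) fun x _ => ?_
    rw [chi_flipOn ((Finset.mem_powerset.mp hP).trans h)]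
    ring
  simp only [fourierCoef, altSum, Finset.sum_mul]
  rw [Finset.sum_comm, Finset.sum_congr rfl hP, Finset.sum_const, Finset.card_powerset]
  simp
  ring

lemma abs_altSum_le {n : ℕ} {f : (Fin n → Bool) → ℝ} (hf : ∀ x, |f x| ≤ 1)
    (T : Finset (Fin n)) (x : Fin n → Bool) : |altSum f T x| ≤ 2 ^ T.card := by
  refine (Finset.abs_sum_le_sum_abs _ _).trans ?_
  refine (Finset.sum_le_card_nsmul _ _ 1 fun P _ => ?_).trans ?_
  · simpa [abs_mul] using hf _
  · simp

lemma sum_sq_fourierCoef_superset_le {n : ℕ} {f : (Fin n → Bool) → ℝ} (hf : ∀ x, |f x| ≤ 1)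
    (T : Finset (Fin n)) :
    ∑ S ∈ Finset.univ.filter (fun S => T ⊆ S), fourierCoef f S ^ 2
      ≤ (Finset.univ.filter (fun x => altSum f T x ≠ 0)).card / 2 ^ n := by
  have h4 : (0 : ℝ) < (2 ^ T.card) ^ 2 := by positivity
  rw [← mul_le_mul_iff_right₀ h4, Finset.mul_sum]
  calc ∑ S ∈ Finset.univ.filter (fun S => T ⊆ S), (2 ^ T.card) ^ 2 * fourierCoef f S ^ 2
      = ∑ S ∈ Finset.univ.filter (fun S => T ⊆ S), fourierCoef (altSum f T) S ^ 2 := by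
        refine Finset.sum_congr rfl fun S hS => ?_
        rw [fourierCoef_altSum f (Finset.mem_filter.mp hS).2, mul_pow]
    _ ≤ ∑ S, fourierCoef (altSum f T) S ^ 2 :=
        Finset.sum_le_sum_of_subset_of_nonneg (Finset.filter_subset _ _)
          fun _ _ _ => sq_nonneg _
    _ = (∑ x, altSum f T x ^ 2) / 2 ^ n := parseval _
    _ ≤ (∑ x, if altSum f T x ≠ 0 then (2 ^ T.card) ^ 2 else 0) / 2 ^ n := by
        gcongr with x
        split_ifs with h
        · exact sq_le_sq' (abs_le.mp (abs_altSum_le hf T x)).1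
            (abs_le.mp (abs_altSum_le hf T x)).2
        · simp [not_not.mp h]
    _ = _ := by
        rw [← Finset.sum_filter, Finset.sum_const, nsmul_eq_mul]
        ring

lemma altSum_eq_zero_of_const {n : ℕ} {f : (Fin n → Bool) → ℝ} {T : Finset (Fin n)}
    (hT : T.Nonempty) {x : Fin n → Bool} {c : ℝ} (h : ∀ P ⊆ T, f (flipOn P x) = c) :
    altSum f T x = 0 := by
  have h1 : altSum f T x = ∑ P ∈ T.powerset, (-1 : ℝ) ^ P.card * c :=
    Finset.sum_congr rfl fun P hP => by rw [h P (Finset.mem_powerset.mp hP)]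
  have h2 := congrArg (Int.cast : ℤ → ℝ) (Finset.sum_powerset_neg_one_pow_card_of_nonempty hT)
  push_cast at h2
  rw [h1, ← Finset.sum_mul, h2, zero_mul]

lemma exists_altSum_sdiff_ne_zero {n : ℕ} {f : (Fin n → Bool) → ℝ} {T Y : Finset (Fin n)}
    (hY : Y ⊆ T) {x : Fin n → Bool} (h : altSum f T x ≠ 0) :
    ∃ P ⊆ Y, altSum f (T \ Y) (flipOn P x) ≠ 0 := by
  by_contra! h0
  refine h ?_
  rw [altSum, ← Finset.sum_fiberwise_of_maps_to (t := Y.powerset) (g := fun P => P ∩ Y)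
    (fun P _ => by simp)]
  refine Finset.sum_eq_zero fun Q hQ => ?_
  have hQ' := Finset.mem_powerset.mp hQ
  have hdisj : ∀ R ∈ (T \ Y).powerset, Disjoint R Q := fun R hR =>
    (Finset.disjoint_of_subset_left (Finset.mem_powerset.mp hR)
      Finset.sdiff_disjoint).mono_right hQ'
  trans (-1) ^ Q.card * altSum f (T \ Y) (flipOn Q x)
  · rw [altSum, Finset.mul_sum]
    symm
    refine Finset.sum_bij' (fun R _ => R ∪ Q) (fun P _ => P \ Y) ?_ ?_ ?_ ?_ ?_
    · intro R hR
      have := Finset.mem_powerset.mp hR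
      simp only [Finset.mem_filter, Finset.mem_powerset]
      refine ⟨by grind, by grind⟩
    · intro P hP
      simp only [Finset.mem_filter, Finset.mem_powerset] at hP ⊢
      exact Finset.sdiff_subset_sdiff hP.1 subset_rfl
    · intro R hR
      have := Finset.mem_powerset.mp hR
      grind
    · intro P hP
      simp only [Finset.mem_filter, Finset.mem_powerset] at hP
      grind
    · intro R hR
      rw [flipOn_flipOn_of_disjoint (hdisj R hR), Finset.card_union_of_disjoint (hdisj R hR)]
      ring
  · rw [h0 Q hQ', mul_zero]

lemma Finset.sum_biUnion_le_sum_sum {ι α : Type*} [DecidableEq α] (s : Finset ι)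
    (t : ι → Finset α) {g : α → ℝ} (hg : ∀ a, 0 ≤ g a) :
    ∑ a ∈ s.biUnion t, g a ≤ ∑ i ∈ s, ∑ a ∈ t i, g a := by
  induction s using Finset.induction_on with
  | empty => simp
  | insert i s hi ih =>
    rw [Finset.biUnion_insert, Finset.sum_insert hi]
    have h1 := Finset.sum_union_inter (s₁ := t i) (s₂ := s.biUnion t) (f := g)
    have h2 : 0 ≤ ∑ a ∈ t i ∩ s.biUnion t, g a := Finset.sum_nonneg fun a _ => hg a
    linarith

lemma Finset.sum_image_le_sum {ι α : Type*} [DecidableEq α] (s : Finset ι) (t : ι → α) {g : α → ℝ}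
    (hg : ∀ a, 0 ≤ g a) : ∑ a ∈ s.image t, g a ≤ ∑ i ∈ s, g (t i) := by
  rw [← Finset.biUnion_singleton]
  simpa using Finset.sum_biUnion_le_sum_sum s (fun i => {t i}) hg

/-- The pairs `(T, x)` that Razborov's decoding procedure recovers from `y` in at most `r` rounds,
where `V y` is the block of variables to be examined at `y`. -/
noncomputable def decode {n : ℕ} (V : (Fin n → Bool) → Finset (Fin n)) :
    ℕ → (Fin n → Bool) → Finset (Finset (Fin n) × (Fin n → Bool))
  | 0, y => {(∅, y)}
  | r + 1, y => insert (∅, y) ((V y).powerset.erase ∅ |>.biUnion fun Y =>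
      (Y.powerset ×ˢ Y.powerset).biUnion fun PQ =>
        ((decode V r (flipOn PQ.1 y)).filter (fun p => Disjoint Y p.1)).image
          (fun p => (Y ∪ p.1, flipOn PQ.2 p.2)))

lemma sum_decode_le {n : ℕ} {V : (Fin n → Bool) → Finset (Fin n)} {t : ℝ} (ht : 0 ≤ t)
    (hV : ∀ y, (1 + 4 * t) ^ (V y).card ≤ 3 / 2) (r : ℕ) (y : Fin n → Bool) :
    ∑ p ∈ decode V r y, t ^ p.1.card ≤ 2 := by
  have hnn : ∀ p : Finset (Fin n) × (Fin n → Bool), 0 ≤ t ^ p.1.card := fun p => by positivity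
  induction r generalizing y with
  | zero => simp [decode]
  | succ r ih =>
    have hround : ∀ Y : Finset (Fin n), ∑ p ∈ (Y.powerset ×ˢ Y.powerset).biUnion (fun PQ =>
        ((decode V r (flipOn PQ.1 y)).filter (fun p => Disjoint Y p.1)).image
          (fun p => (Y ∪ p.1, flipOn PQ.2 p.2))), t ^ p.1.card ≤ (4 * t) ^ Y.card * 2 := by
      intro Y
      refine (Finset.sum_biUnion_le_sum_sum _ _ hnn).trans ?_
      refine (Finset.sum_le_card_nsmul _ _ (t ^ Y.card * 2) fun PQ _ => ?_).trans ?_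
      · refine (Finset.sum_image_le_sum _ _ hnn).trans ?_
        calc ∑ p ∈ (decode V r (flipOn PQ.1 y)).filter (fun p => Disjoint Y p.1),
              t ^ (Y ∪ p.1).card
            = ∑ p ∈ (decode V r (flipOn PQ.1 y)).filter (fun p => Disjoint Y p.1),
              t ^ Y.card * t ^ p.1.card := by
              refine Finset.sum_congr rfl fun p hp => ?_
              rw [Finset.card_union_of_disjoint (Finset.mem_filter.mp hp).2, pow_add]
          _ ≤ ∑ p ∈ decode V r (flipOn PQ.1 y), t ^ Y.card * t ^ p.1.card :=
              Finset.sum_le_sum_of_subset_of_nonneg (Finset.filter_subset _ _)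
                fun _ _ _ => by positivity
          _ ≤ t ^ Y.card * 2 := by
              rw [← Finset.mul_sum]
              gcongr
              exact ih _
      · rw [Finset.card_product, Finset.card_powerset, nsmul_eq_mul, mul_pow]
        push_cast
        rw [← mul_pow]
        norm_num
        linarith
    rw [decode]
    have hins : ∀ s : Finset (Finset (Fin n) × (Fin n → Bool)),
        ∑ p ∈ insert (∅, y) s, t ^ p.1.card ≤ 1 + ∑ p ∈ s, t ^ p.1.card := by
      intro s
      have h1 := Finset.sum_union_inter (s₁ := {((∅ : Finset (Fin n)), y)}) (s₂ := s)
        (f := fun p => t ^ p.1.card)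
      have h2 : 0 ≤ ∑ p ∈ {((∅ : Finset (Fin n)), y)} ∩ s, t ^ p.1.card :=
        Finset.sum_nonneg fun p _ => hnn p
      rw [Finset.insert_eq]
      simp only [Finset.sum_singleton, Finset.card_empty, pow_zero] at h1
      linarith
    refine (hins _).trans ?_
    have h3 := (Finset.sum_biUnion_le_sum_sum ((V y).powerset.erase ∅) _ hnn).trans
      (Finset.sum_le_sum fun Y _ => hround Y)
    have h4 : ∑ Y ∈ (V y).powerset.erase ∅, (4 * t) ^ Y.card * 2
        = ((1 + 4 * t) ^ (V y).card - 1) * 2 := by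
      rw [← Finset.sum_mul, Finset.sum_erase_eq_sub (Finset.empty_mem_powerset _)]
      have := Finset.sum_pow_mul_eq_add_pow (4 * t) 1 (V y)
      simp only [one_pow, mul_one] at this
      rw [this]
      simp [add_comm]
    have h5 := hV y
    linarith

lemma mem_decode_of_altSum_ne_zero {n : ℕ} {f : (Fin n → Bool) → ℝ}
    {V : (Fin n → Bool) → Finset (Fin n)}
    (hV : ∀ (T : Finset (Fin n)) (x : Fin n → Bool), T.Nonempty → altSum f T x ≠ 0 →
      ∃ (A : Finset (Fin n)) (z : Fin n → Bool), (A ∩ T).Nonempty ∧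
        ∀ y : Fin n → Bool, (∀ i ∉ T, y i = x i) → (∀ i ∈ A ∩ T, y i = z i) → V y = A)
    (r : ℕ) (T : Finset (Fin n)) (hr : T.card ≤ r) (x : Fin n → Bool) (h : altSum f T x ≠ 0) :
    ∃ y, (∀ i ∉ T, y i = x i) ∧ (T, x) ∈ decode V r y := by
  induction r generalizing T x with
  | zero =>
    obtain rfl : T = ∅ := by simpa using hr
    exact ⟨x, by simp, by simp [decode]⟩
  | succ r ih =>
    rcases T.eq_empty_or_nonempty with rfl | hT
    · exact ⟨x, by simp, by simp [decode]⟩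
    obtain ⟨A, z, hne, hA⟩ := hV T x hT h
    obtain ⟨P, hP, hPne⟩ := exists_altSum_sdiff_ne_zero (Finset.inter_subset_right (s₁ := A)) h
    have hcard : (T \ (A ∩ T)).card ≤ r := by
      have h1 := Finset.card_sdiff_add_card_inter T (A ∩ T)
      have h2 : T ∩ (A ∩ T) = A ∩ T := by grind
      rw [h2] at h1
      have := hne.card_pos
      omega
    obtain ⟨y', hy', hmem⟩ := ih _ hcard _ hPne
    let y : Fin n → Bool := fun i => if i ∈ A ∩ T then z i else y' i
    have hyx : ∀ i ∉ T, y i = x i := by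
      intro i hi
      have hi' : i ∉ A ∩ T := fun hc => hi (Finset.mem_inter.mp hc).2
      have := hy' i (fun hc => hi (Finset.mem_sdiff.mp hc).1)
      rw [flipOn_apply_of_notMem (fun hc => hi' (hP hc))] at this
      simp only [y, if_neg hi', this]
    have hVy : V y = A := hA y hyx fun i hi => by simp only [y, if_pos hi]
    obtain ⟨P', hP', hPy⟩ := exists_flipOn_eq (Y := A ∩ T) (x := y) (y := y')
      fun i hi => by simp only [y, if_neg hi]
    refine ⟨y, hyx, ?_⟩
    rw [decode]
    refine Finset.mem_insert_of_mem ?_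
    simp only [Finset.mem_biUnion, Finset.mem_erase, Finset.mem_powerset, Finset.mem_product,
      Finset.mem_image, Finset.mem_filter, hVy]
    refine ⟨A ∩ T, ⟨hne.ne_empty, Finset.inter_subset_left⟩, (P', P), ⟨hP', hP⟩, _,
      ⟨hPy ▸ hmem, Finset.disjoint_sdiff⟩, ?_⟩
    simp only [flipOn_flipOn, Prod.mk.injEq, and_true]
    exact Finset.union_sdiff_of_subset Finset.inter_subset_right

lemma sum_altSum_ne_zero_le {n : ℕ} {f : (Fin n → Bool) → ℝ}
    {V : (Fin n → Bool) → Finset (Fin n)}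
    (hV : ∀ (T : Finset (Fin n)) (x : Fin n → Bool), T.Nonempty → altSum f T x ≠ 0 →
      ∃ (A : Finset (Fin n)) (z : Fin n → Bool), (A ∩ T).Nonempty ∧
        ∀ y : Fin n → Bool, (∀ i ∉ T, y i = x i) → (∀ i ∈ A ∩ T, y i = z i) → V y = A)
    {t : ℝ} (ht : 0 ≤ t) (hVt : ∀ y, (1 + 4 * t) ^ (V y).card ≤ 3 / 2) :
    ∑ T : Finset (Fin n), t ^ T.card * (Finset.univ.filter (fun x => altSum f T x ≠ 0)).card
      ≤ 2 ^ n * 2 := by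
  have hnn : ∀ p : Finset (Fin n) × (Fin n → Bool), 0 ≤ t ^ p.1.card := fun p => by positivity
  calc ∑ T : Finset (Fin n),
        t ^ T.card * ((Finset.univ.filter (fun x => altSum f T x ≠ 0)).card : ℝ)
      = ∑ p ∈ Finset.univ.filter
          (fun p : Finset (Fin n) × (Fin n → Bool) => altSum f p.1 p.2 ≠ 0), t ^ p.1.card := by
        rw [Finset.sum_filter, Fintype.sum_prod_type]
        refine Finset.sum_congr rfl fun T _ => ?_
        simp only [← Finset.sum_filter, Finset.sum_const, nsmul_eq_mul, mul_comm]
    _ ≤ ∑ p ∈ Finset.univ.biUnion (decode V n), t ^ p.1.card := by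
        refine Finset.sum_le_sum_of_subset_of_nonneg (fun p hp => ?_) fun p _ _ => hnn p
        obtain ⟨y, -, hy⟩ := mem_decode_of_altSum_ne_zero hV n p.1
          ((Finset.card_le_univ _).trans (by simp)) p.2 (Finset.mem_filter.mp hp).2
        exact Finset.mem_biUnion.mpr ⟨y, Finset.mem_univ _, hy⟩
    _ ≤ ∑ y, ∑ p ∈ decode V n y, t ^ p.1.card := Finset.sum_biUnion_le_sum_sum _ _ hnn
    _ ≤ 2 ^ n * 2 := by
        refine (Finset.sum_le_card_nsmul _ _ 2 fun y _ => sum_decode_le ht hVt n y).trans ?_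
        simp

lemma sum_sq_fourierCoef_mul_pow_le {n : ℕ} {f : (Fin n → Bool) → ℝ} (hf : ∀ x, |f x| ≤ 1)
    {t : ℝ} (ht : 0 ≤ t) :
    ∑ S, fourierCoef f S ^ 2 * (1 + t) ^ S.card
      ≤ (∑ T : Finset (Fin n),
          t ^ T.card * (Finset.univ.filter (fun x => altSum f T x ≠ 0)).card) / 2 ^ n := by
  have hpow : ∀ S : Finset (Fin n), (1 + t) ^ S.card = ∑ T, if T ⊆ S then t ^ T.card else 0 := by
    intro S
    have := Finset.sum_pow_mul_eq_add_pow t 1 S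
    simp only [one_pow, mul_one] at this
    rw [add_comm, ← this, ← Finset.sum_filter]
    refine Finset.sum_congr ?_ fun _ _ => rfl
    ext
    simp
  simp_rw [hpow, Finset.mul_sum]
  rw [Finset.sum_comm, Finset.sum_div]
  refine Finset.sum_le_sum fun T _ => ?_
  calc ∑ S, fourierCoef f S ^ 2 * (if T ⊆ S then t ^ T.card else 0)
      = t ^ T.card * ∑ S ∈ Finset.univ.filter (fun S => T ⊆ S), fourierCoef f S ^ 2 := by
        rw [Finset.mul_sum, Finset.sum_filter]
        refine Finset.sum_congr rfl fun S _ => ?_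
        split_ifs <;> ring
    _ ≤ t ^ T.card * ((Finset.univ.filter (fun x => altSum f T x ≠ 0)).card / 2 ^ n) := by
        gcongr
        exact sum_sq_fourierCoef_superset_le hf T
    _ = _ := by ring

lemma exists_first_ne_one_support {n m w : ℕ} (g : Fin m → (Fin n → Bool) → ℝ)
    {supp : Fin m → Finset (Fin n)} (hw : ∀ i, (supp i).card ≤ w) (y : Fin n → Bool) :
    ∃ A : Finset (Fin n), A.card ≤ w ∧
      ∀ i, g i y ≠ 1 → (∀ j < i, g j y = 1) → supp i = A := by
  by_cases h : ∃ i, g i y ≠ 1 ∧ ∀ j < i, g j y = 1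
  · obtain ⟨i, hi, hlt⟩ := h
    refine ⟨supp i, hw i, fun k hk hklt => ?_⟩
    rcases lt_trichotomy i k with hik | rfl | hik
    · exact absurd (hklt i hik) hi
    · rfl
    · exact absurd (hlt k hik) hk
  · exact ⟨∅, by simp, fun i hi hlt => absurd ⟨i, hi, hlt⟩ h⟩

/-- An exponentially weighted Fourier bound for conjunctions of Boolean functions of width `w`. -/
lemma sum_sq_fourierCoef_prod_mul_pow_le_of_boolean {n m w : ℕ}
    {g : Fin m → (Fin n → Bool) → ℝ} {supp : Fin m → Finset (Fin n)}
    (hw : ∀ i, (supp i).card ≤ w) (hsupp : ∀ i, DependsOnlyOn (g i) (supp i))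
    (hg : ∀ i x, g i x = 0 ∨ g i x = 1) {t : ℝ} (ht : 0 ≤ t) (htw : (1 + 4 * t) ^ w ≤ 3 / 2) :
    ∑ S, fourierCoef (fun x => ∏ i, g i x) S ^ 2 * (1 + t) ^ S.card ≤ 2 := by
  choose V hVw hV using exists_first_ne_one_support g hw
  have hf : ∀ x, |∏ i, g i x| ≤ 1 := by
    intro x
    rw [Finset.abs_prod]
    refine Finset.prod_le_one (fun i _ => abs_nonneg _) fun i _ => ?_
    rcases hg i x with h | h <;> simp [h]
  refine (sum_sq_fourierCoef_mul_pow_le hf ht).trans ?_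
  rw [div_le_iff₀ (by positivity), mul_comm]
  refine sum_altSum_ne_zero_le (V := V) ?_ ht fun y =>
    (pow_le_pow_right₀ (by linarith) (hVw y)).trans htw
  intro T x hT hne
  have hflip : ∀ P ⊆ T, ∀ i ∉ T, flipOn P x i = x i := fun P hP i hi =>
    flipOn_apply_of_notMem (fun hc => hi (hP hc)) x
  have hex : ∃ i, ∃ z : Fin n → Bool, (∀ k ∉ T, z k = x k) ∧ g i z ≠ 1 := by
    by_contra! hall
    refine hne (altSum_eq_zero_of_const hT (c := 1) fun P hP => ?_)
    exact Finset.prod_eq_one fun i _ => hall i _ (hflip P hP)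
  let s : Finset (Fin m) :=
    Finset.univ.filter fun i => ∃ z : Fin n → Bool, (∀ k ∉ T, z k = x k) ∧ g i z ≠ 1
  have hs : s.Nonempty := hex.imp fun i hi => Finset.mem_filter.mpr ⟨Finset.mem_univ _, hi⟩
  obtain ⟨i, his, hmin⟩ := s.exists_min_image id hs
  obtain ⟨z, hzx, hz⟩ := (Finset.mem_filter.mp his).2
  have hgi : ∀ y : Fin n → Bool, (∀ k ∉ T, y k = x k) → (∀ k ∈ supp i ∩ T, y k = z k) →
      g i y = g i z := by
    intro y hyx hyz
    refine hsupp i y z fun k hk => ?_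
    by_cases hkT : k ∈ T
    · exact hyz k (Finset.mem_inter.mpr ⟨hk, hkT⟩)
    · rw [hyx k hkT, hzx k hkT]
  refine ⟨supp i, z, ?_, fun y hyx hyz => (hV y i ?_ ?_).symm⟩
  · by_contra hempty
    rw [Finset.not_nonempty_iff_eq_empty] at hempty
    refine hne (altSum_eq_zero_of_const hT (c := 0) fun P hP => ?_)
    refine Finset.prod_eq_zero (Finset.mem_univ i) ?_
    rw [hgi _ (hflip P hP) (by simp [hempty])]
    exact (hg i z).resolve_right hz
  · rwa [hgi y hyx hyz]
  · intro j hji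
    by_contra hj
    have hjs : j ∈ s := Finset.mem_filter.mpr ⟨Finset.mem_univ _, y, hyx, hj⟩
    exact absurd (hmin j hjs) (not_le.mpr hji)

/-- Functions of the variables in `T` with values in the unit interval are convex combinations of
Boolean-valued functions of the same variables. -/
lemma mem_convexHull_boolean {n : ℕ} {g : (Fin n → Bool) → ℝ} {T : Finset (Fin n)}
    (hT : DependsOnlyOn g T) (h0 : ∀ x, 0 ≤ g x) (h1 : ∀ x, g x ≤ 1) :
    g ∈ convexHull ℝ
      {b : (Fin n → Bool) → ℝ | DependsOnlyOn b T ∧ ∀ x, b x = 0 ∨ b x = 1} := by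
  let r : (Fin n → Bool) → (Fin n → Bool) := fun x i => if i ∈ T then x i else false
  have hr : ∀ x, g (r x) = g x := fun x => hT _ _ fun i hi => by simp [r, hi]
  have hcube : g ∈ convexHull ℝ (Set.univ.pi fun _ : Fin n → Bool => ({0, 1} : Set ℝ)) := by
    rw [convexHull_pi]
    intro x _
    rw [convexHull_pair, segment_eq_Icc zero_le_one]
    exact ⟨h0 x, h1 x⟩
  have himage : g ∈ LinearMap.funLeft ℝ ℝ r ''
      convexHull ℝ (Set.univ.pi fun _ : Fin n → Bool => ({0, 1} : Set ℝ)) :=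
    ⟨g, hcube, funext hr⟩
  rw [LinearMap.image_convexHull] at himage
  refine convexHull_mono ?_ himage
  rintro _ ⟨b, hb, rfl⟩
  refine ⟨fun x y hxy => ?_, fun x => by simpa using hb (r x) (Set.mem_univ _)⟩
  have : r x = r y := funext fun i => by
    by_cases hi : i ∈ T
    · simp [r, hi, hxy i hi]
    · simp [r, hi]
  simp [LinearMap.funLeft_apply, this]

lemma fourierCoef_mul_combo {n : ℕ} (a b : ℝ) (g h k : (Fin n → Bool) → ℝ)
    (S : Finset (Fin n)) :
    fourierCoef (fun x => (a • g + b • h) x * k x) S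
      = a * fourierCoef (fun x => g x * k x) S + b * fourierCoef (fun x => h x * k x) S := by
  simp only [fourierCoef, Pi.add_apply, Pi.smul_apply, smul_eq_mul]
  rw [mul_div_assoc', mul_div_assoc', ← add_div, Finset.mul_sum, Finset.mul_sum,
    ← Finset.sum_add_distrib]
  congr 1
  exact Finset.sum_congr rfl fun x _ => by ring

lemma convexOn_sum_sq_fourierCoef_mul {n : ℕ} {c : Finset (Fin n) → ℝ} (hc : ∀ S, 0 ≤ c S)
    (k : (Fin n → Bool) → ℝ) :
    ConvexOn ℝ Set.univ
      (fun g : (Fin n → Bool) → ℝ => ∑ S, fourierCoef (fun x => g x * k x) S ^ 2 * c S) := by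
  refine ⟨convex_univ, fun g _ h _ a b ha hb hab => ?_⟩
  simp only [smul_eq_mul]
  rw [Finset.mul_sum, Finset.mul_sum, ← Finset.sum_add_distrib]
  refine Finset.sum_le_sum fun S _ => ?_
  rw [fourierCoef_mul_combo]
  obtain rfl : b = 1 - a := by linarith
  set p := fourierCoef (fun x => g x * k x) S
  set q := fourierCoef (fun x => h x * k x) S
  have h2 : 0 ≤ a * (1 - a) * (p - q) ^ 2 * c S := by
    have := hc S
    positivity
  linarith

lemma sum_sq_fourierCoef_prod_mul_pow_le {n m w : ℕ} {supp : Fin m → Finset (Fin n)}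
    (hw : ∀ i, (supp i).card ≤ w) {t : ℝ} (ht : 0 ≤ t) (htw : (1 + 4 * t) ^ w ≤ 3 / 2)
    (A : Finset (Fin m)) {g : Fin m → (Fin n → Bool) → ℝ}
    (hsupp : ∀ i, DependsOnlyOn (g i) (supp i)) (h0 : ∀ i x, 0 ≤ g i x) (h1 : ∀ i x, g i x ≤ 1)
    (hA : ∀ i ∉ A, ∀ x, g i x = 0 ∨ g i x = 1) :
    ∑ S, fourierCoef (fun x => ∏ i, g i x) S ^ 2 * (1 + t) ^ S.card ≤ 2 := by
  induction A using Finset.induction_on generalizing g with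
  | empty =>
    exact sum_sq_fourierCoef_prod_mul_pow_le_of_boolean hw hsupp (by simpa using hA) ht htw
  | insert i A hi ih =>
    obtain ⟨b, ⟨hbT, hb⟩, hle⟩ := (convexOn_sum_sq_fourierCoef_mul
      (c := fun S : Finset (Fin n) => (1 + t) ^ S.card) (fun S => by positivity)
      (fun x => ∏ j ∈ Finset.univ.erase i, g j x)).exists_ge_of_mem_convexHull
      (Set.subset_univ _) (mem_convexHull_boolean (hsupp i) (h0 i) (h1 i))
    have hprod : ∀ x, b x * ∏ j ∈ Finset.univ.erase i, g j x
        = ∏ j, Function.update g i b j x := by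
      intro x
      rw [← Finset.mul_prod_erase _ _ (Finset.mem_univ i), Function.update_self]
      congr 1
      refine Finset.prod_congr rfl fun j hj => ?_
      rw [Function.update_of_ne (Finset.ne_of_mem_erase hj)]
    have hg : ∀ x, g i x * ∏ j ∈ Finset.univ.erase i, g j x = ∏ j, g j x := fun x =>
      Finset.mul_prod_erase _ (fun j => g j x) (Finset.mem_univ i)
    simp only [hg, hprod] at hle
    refine hle.trans (ih ?_ ?_ ?_ ?_)
    · intro j
      by_cases hj : j = i
      · subst hj
        simpa using hbT
      · simpa [hj] using hsupp j
    · intro j x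
      by_cases hj : j = i
      · subst hj
        rcases hb x with h | h <;> simp [h]
      · simpa [hj] using h0 j x
    · intro j x
      by_cases hj : j = i
      · subst hj
        rcases hb x with h | h <;> simp [h]
      · simpa [hj] using h1 j x
    · intro j hj x
      by_cases hji : j = i
      · subst hji
        simpa using hb x
      · simpa [hji] using hA j (by simp [hji, hj]) x

lemma sum_sq_fourierCoef_nonempty {n : ℕ} (f : (Fin n → Bool) → ℝ) :
    ∑ S ∈ Finset.univ.erase ∅, fourierCoef f S ^ 2
      = (∑ x, f x ^ 2) / 2 ^ n - ((∑ x, f x) / 2 ^ n) ^ 2 := by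
  rw [Finset.sum_erase_eq_sub (Finset.mem_univ _), parseval]
  simp [fourierCoef, chi]

lemma sum_sq_fourierCoef_nonempty_le {n : ℕ} {f : (Fin n → Bool) → ℝ} (h0 : ∀ x, 0 ≤ f x)
    (h1 : ∀ x, f x ≤ 1) : ∑ S ∈ Finset.univ.erase ∅, fourierCoef f S ^ 2 ≤ 1 / 4 := by
  rw [sum_sq_fourierCoef_nonempty]
  have h : (∑ x, f x ^ 2) / 2 ^ n ≤ (∑ x, f x) / 2 ^ n := by
    gcongr with x
    nlinarith [h0 x, h1 x]
  nlinarith [sq_nonneg ((∑ x, f x) / 2 ^ n - 1 / 2)]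

lemma one_add_pow_le_three_halves {w : ℕ} (hw : 1 ≤ w) :
    (1 + 4 * (1 / (16 * w) : ℝ)) ^ w ≤ 3 / 2 := by
  have hw' : (0 : ℝ) < w := by exact_mod_cast hw
  calc (1 + 4 * (1 / (16 * w) : ℝ)) ^ w ≤ Real.exp (4 * (1 / (16 * w))) ^ w := by
        gcongr
        rw [add_comm]
        exact Real.add_one_le_exp _
    _ = Real.exp (1 / 4) := by
        rw [← Real.exp_nat_mul]
        congr 1
        field_simp
        norm_num
    _ ≤ 1 / (1 - 1 / 4) := Real.exp_bound_div_one_sub_of_interval (by norm_num) (by norm_num)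
    _ ≤ 3 / 2 := by norm_num

lemma exp_half_le_one_add {t : ℝ} (h0 : 0 ≤ t) (h1 : t ≤ 1) : Real.exp (t / 2) ≤ 1 + t := by
  refine (Real.exp_bound_div_one_sub_of_interval (by linarith) (by linarith)).trans ?_
  rw [div_le_iff₀ (by linarith)]
  nlinarith

lemma tail_lt_of_weighted_sum_le {n w : ℕ} (hw : 1 ≤ w) {f : (Fin n → Bool) → ℝ}
    (hf : ∑ S, fourierCoef f S ^ 2 * (1 + 1 / (16 * w) : ℝ) ^ S.card ≤ 2) {ε : ℝ} (h0 : 0 < ε)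
    (h4 : ε ≤ 1 / 4) {K : ℝ} (hK : 96 * w * Real.log (1 / ε) ≤ K) :
    ∑ S ∈ Finset.univ.filter (fun S : Finset (Fin n) => K < S.card), fourierCoef f S ^ 2 < ε := by
  have hw' : (1 : ℝ) ≤ w := by exact_mod_cast hw
  have ht1 : (1 / (16 * w) : ℝ) ≤ 1 := by
    rw [div_le_one (by positivity)]
    linarith
  have hpow : ∀ S : Finset (Fin n), K < S.card →
      (1 / ε) ^ 3 ≤ (1 + 1 / (16 * w) : ℝ) ^ S.card := by
    intro S hS
    calc (1 / ε) ^ 3 = Real.exp (3 * Real.log (1 / ε)) := by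
          rw [← Real.exp_log (show (0 : ℝ) < 1 / ε by positivity), ← Real.exp_nat_mul,
            Real.log_exp]
          norm_num
      _ ≤ Real.exp (S.card * (1 / (16 * w) / 2)) := by
          rw [Real.exp_le_exp]
          have : 96 * w * Real.log (1 / ε) ≤ S.card := hK.trans hS.le
          have h2 : 3 * Real.log (1 / ε) = 96 * w * Real.log (1 / ε) * (1 / (16 * w) / 2) := by
            field_simp
            ring
          rw [h2]
          gcongr
      _ ≤ (1 + 1 / (16 * w) : ℝ) ^ S.card := by
          rw [Real.exp_nat_mul]
          gcongr
          exact exp_half_le_one_add (by positivity) ht1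
  have hsum : (∑ S ∈ Finset.univ.filter (fun S : Finset (Fin n) => K < S.card),
      fourierCoef f S ^ 2) * (1 / ε) ^ 3 ≤ 2 := by
    rw [Finset.sum_mul]
    refine le_trans (Finset.sum_le_sum fun S hS => ?_)
      ((Finset.sum_le_sum_of_subset_of_nonneg (Finset.filter_subset _ _)
        fun S _ _ => by positivity).trans hf)
    exact mul_le_mul_of_nonneg_left (hpow S (Finset.mem_filter.mp hS).2) (sq_nonneg _)
  rw [div_pow, one_pow, mul_one_div, div_le_iff₀ (by positivity)] at hsum
  nlinarith [mul_pos h0 h0]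

/-- Main concentration theorem: there is a universal constant C such that for every product
f of contractive width-w factors with gap 1-η and every 0 < ε < 1, the Fourier weight of f
above degree C·w·log(1/ε)·u is less than ε, where u = ⌈log_η ε⌉ + 1 if η > 0 and u = 1
if η = 0. -/
theorem main_low_degree_concentration :
    ∃ C : ℝ, 0 < C ∧
      ∀ (n m w : ℕ) (f : (Fin n → Bool) → ℝ) (fs : Fin m → (Fin n → Bool) → ℝ)
        (η : ℝ), 0 ≤ η → η < 1 →
        (∀ x, f x = ∏ i : Fin m, fs i x) →
        (∀ i : Fin m, HasWidth (fs i) w ∧ Contractive (fs i) η) →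
        ∀ ε : ℝ, 0 < ε → ε < 1 →
          ∀ u : ℝ,
            u = (if η = 0 then 1 else ((⌈Real.log ε / Real.log η⌉ : ℤ) : ℝ) + 1) →
            ∑ S ∈ Finset.univ.filter
                (fun S : Finset (Fin n) => (C * w * Real.log (1 / ε) * u : ℝ) < S.card),
              fourierCoef f S ^ 2 < ε := by
  refine ⟨96, by norm_num, ?_⟩
  intro n m w f fs η hη0 hη1 hf hfs ε hε0 hε1 u hu
  obtain rfl : f = fun x => ∏ i, fs i x := funext hf
  have hlog : 0 < Real.log (1 / ε) := Real.log_pos (by rwa [lt_div_iff₀ hε0, one_mul])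
  have hu1 : 1 ≤ u := by
    rw [hu]
    split_ifs with h
    · rfl
    · have hpos : 0 ≤ Real.log ε / Real.log η :=
        div_nonneg_of_nonpos (Real.log_nonpos hε0.le hε1.le) (Real.log_nonpos hη0 hη1.le)
      have : (0 : ℝ) ≤ (⌈Real.log ε / Real.log η⌉ : ℤ) := by exact_mod_cast Int.ceil_nonneg hpos
      linarith
  have hbase : 0 ≤ 96 * w * Real.log (1 / ε) := by positivity
  have hK : 96 * w * Real.log (1 / ε) ≤ 96 * w * Real.log (1 / ε) * u :=
    le_mul_of_one_le_right hbase hu1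
  have hnonempty : ∑ S ∈ Finset.univ.filter
      (fun S : Finset (Fin n) => (96 * w * Real.log (1 / ε) * u : ℝ) < S.card),
        fourierCoef (fun x => ∏ i, fs i x) S ^ 2
      ≤ ∑ S ∈ Finset.univ.erase ∅, fourierCoef (fun x => ∏ i, fs i x) S ^ 2 := by
    refine Finset.sum_le_sum_of_subset_of_nonneg (fun S hS => ?_) fun _ _ _ => sq_nonneg _
    refine Finset.mem_erase.mpr ⟨?_, Finset.mem_univ _⟩
    rintro rfl
    have := (Finset.mem_filter.mp hS).2
    simp only [Finset.card_empty, Nat.cast_zero] at this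
    linarith
  choose supp hcard hsupp using fun i => (hfs i).1
  have h0 : ∀ i x, 0 ≤ fs i x := fun i => (hfs i).2.1
  have h1 : ∀ i x, fs i x ≤ 1 := fun i => (hfs i).2.2.1
  rcases lt_or_ge (1 / 4) ε with hε | hε
  · refine (hnonempty.trans (sum_sq_fourierCoef_nonempty_le ?_ ?_)).trans_lt hε
    · exact fun x => Finset.prod_nonneg fun i _ => h0 i x
    · exact fun x => Finset.prod_le_one (fun i _ => h0 i x) fun i _ => h1 i x
  rcases Nat.eq_zero_or_pos w with rfl | hw
  · refine hnonempty.trans_lt ?_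
    have hone : ∀ x, ∏ i, fs i x = 1 := fun x => Finset.prod_eq_one fun i _ => by
      obtain ⟨z, hz⟩ := (hfs i).2.2.2.1
      rw [← hz]
      refine hsupp i x z fun k hk => ?_
      simp [Finset.card_eq_zero.mp (Nat.le_zero.mp (hcard i))] at hk
    rw [sum_sq_fourierCoef_nonempty]
    simpa [hone] using hε0
  · exact tail_lt_of_weighted_sum_le hw
      (sum_sq_fourierCoef_prod_mul_pow_le hcard (by positivity) (one_add_pow_le_three_halves hw)
        Finset.univ hsupp h0 h1 (by simp)) hε0 hε hK
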